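/- Define N_D(τ) = Σ_{(k,n)∈ℕ², (k²−k+1)(n²+1)^{3/4}<τ} 2(2k+1) and Z = Σ_{n∈ℕ} 2(n²+1)^{−3/4}. Then limsup_{τ→+∞} |N_D(τ) − Z·τ| / τ^{2/3} ≥ 2 > 0. -/

import Mathlib

open Filter Topology

/-- Counting function of `A₁`. -/
lemma exists_count (x : ℝ) : ∃ C : ℕ, (∀ k : ℕ, k < C ↔ (k : ℝ) ^ 2 - k + 1 < x) ∧
    (∀ y : ℝ, 0 < y → x = y ^ 2 → 1 < x →
      x + y - 3 / 4 ≤ (C : ℝ) ^ 2 ∧ (C : ℝ) ^ 2 ≤ x + 6 * y) := by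
  by_cases hx : x ≤ 1
  · refine ⟨0, ?_, ?_⟩
    · intro k
      simp only [not_lt_zero, false_iff, not_lt]
      have : (k : ℝ) ≤ (k : ℝ) ^ 2 := by exact_mod_cast Nat.le_self_pow (by norm_num) k
      linarith
    · intro y _ _ h; linarith
  · push Not at hx
    have hex : ∃ K : ℕ, x ≤ (K : ℝ) ^ 2 + K + 1 := by
      obtain ⟨K, hK⟩ := exists_nat_ge x
      exact ⟨K, by nlinarith [sq_nonneg (K : ℝ)]⟩
    classical
    obtain ⟨K, hK, hmin⟩ : ∃ K : ℕ, x ≤ (K : ℝ) ^ 2 + K + 1 ∧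
        ∀ m < K, ¬ x ≤ (m : ℝ) ^ 2 + m + 1 :=
      ⟨Nat.find hex, Nat.find_spec hex, fun m hm => Nat.find_min hex hm⟩
    obtain _ | J := K
    · norm_num at hK; linarith
    have hJ := hmin J (by omega)
    push Not at hJ
    push_cast at hK
    have hJ0 : (0 : ℝ) ≤ J := Nat.cast_nonneg J
    refine ⟨J + 2, ?_, ?_⟩
    · intro k
      constructor
      · intro hk
        have h1 : (k : ℝ) ≤ J + 1 := by exact_mod_cast Nat.lt_succ_iff.mp hk
        have h0 : (0 : ℝ) ≤ k := Nat.cast_nonneg k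
        nlinarith [mul_nonneg hJ0 (sub_nonneg.2 h1), mul_nonneg h0 (sub_nonneg.2 h1)]
      · intro hk
        by_contra hcon
        have h1 : (J : ℝ) + 2 ≤ k := by exact_mod_cast not_lt.mp hcon
        nlinarith
    · intro y hy hxy _
      push_cast
      constructor
      · have : y ≤ J + 1 + 3 / 4 := by
          apply le_of_sq_le_sq _ (by linarith) <;> nlinarith
        nlinarith
      · have : (J : ℝ) + 1 ≤ 2 * y := by
          by_contra hc
          push Not at hc
          nlinarith [sq_nonneg ((J : ℝ) - 1)]
        nlinarith

lemma tele_quarter (a b : ℝ) (ha : 0 ≤ a) (hab : b ^ 4 = a ^ 4 + 1) (hb : 0 < b) :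
    1 / b ^ 3 ≤ 4 * (b - a) ∧ 4 * (b - a) * a ^ 3 ≤ 1 := by
  have hlt : a ≤ b := by
    apply le_of_not_gt
    intro h
    have := pow_le_pow_left₀ hb.le h.le 4
    linarith
  have e : (b - a) * (b ^ 3 + b ^ 2 * a + b * a ^ 2 + a ^ 3) = 1 := by linear_combination hab
  have h2 : a ^ 2 ≤ b ^ 2 := pow_le_pow_left₀ ha hlt 2
  have h3 : a ^ 3 ≤ b ^ 3 := pow_le_pow_left₀ ha hlt 3
  have h4 : b ^ 2 * a ≤ b ^ 3 := by nlinarith [sq_nonneg b]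
  have h5 : b * a ^ 2 ≤ b ^ 3 := by nlinarith
  have h6 : a ^ 3 ≤ b ^ 2 * a := by nlinarith
  have h7 : a ^ 3 ≤ b * a ^ 2 := by nlinarith [sq_nonneg a]
  have hd : 0 ≤ b - a := by linarith
  constructor
  · rw [div_le_iff₀ (by positivity)]
    nlinarith
  · nlinarith

lemma tele_half (p q : ℝ) (hp : 0 < p) (hq : 0 < q) (h : q ^ 2 = p ^ 2 + 1) :
    1 / q ^ 3 ≤ 2 / p - 2 / q := by
  have hlt : p ≤ q := by
    apply le_of_not_gt
    intro h
    nlinarith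
  have e : (q - p) * (q + p) = 1 := by linear_combination h
  have key : p ≤ 2 * q ^ 2 * (q - p) := by
    have : p * ((q - p) * (q + p)) ≤ 2 * q ^ 2 * (q - p) := by
      have : p * (q + p) ≤ 2 * q ^ 2 := by nlinarith
      nlinarith
    rw [e] at this; linarith
  rw [div_sub_div _ _ hp.ne' hq.ne', div_le_div_iff₀ (by positivity) (by positivity)]
  nlinarith

noncomputable def fr (n : ℕ) : ℝ := √√(n : ℝ)

lemma fr_pow (n : ℕ) : fr n ^ 4 = n := by
  have h1 := Real.sq_sqrt (Nat.cast_nonneg (α := ℝ) n)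
  have h2 := Real.sq_sqrt (Real.sqrt_nonneg (n : ℝ))
  unfold fr
  calc _ = ((√√(n:ℝ)) ^ 2) ^ 2 := by ring
    _ = _ := by rw [h2, h1]

lemma fr_nonneg (n : ℕ) : 0 ≤ fr n := Real.sqrt_nonneg _

lemma fr_pos (n : ℕ) : 0 < fr (n + 1) := by
  unfold fr; positivity

lemma r_bounds (r : ℝ) (n : ℕ) (hr : 0 < r) (h : r ^ 8 = (n : ℝ) ^ 2 + 1) :
    1 / fr (n + 1) ^ 3 ≤ 1 / r ^ 3 ∧ 1 / r ^ 3 ≤ 8 * (1 / fr (n + 1) ^ 3) ∧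
    r ≤ fr (n+1) := by
  have hp := fr_pos n
  have h4 := fr_pow (n + 1)
  have h8 : fr (n + 1) ^ 8 = ((n : ℝ) + 1) ^ 2 := by
    calc _ = (fr (n + 1) ^ 4) ^ 2 := by ring
      _ = _ := by rw [h4]; push_cast; ring
  have hn : (0 : ℝ) ≤ n := Nat.cast_nonneg n
  have h1 : r ≤ fr (n + 1) := by
    apply le_of_pow_le_pow_left₀ (n := 8) (by norm_num) hp.le
    rw [h, h8]; nlinarith
  have h2 : fr (n + 1) ≤ 2 * r := by
    apply le_of_pow_le_pow_left₀ (n := 8) (by norm_num) (by positivity)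
    rw [mul_pow, h, h8]; nlinarith [sq_nonneg ((n:ℝ) - 1)]
  refine ⟨?_, ?_, h1⟩
  · exact one_div_le_one_div_of_le (by positivity) (pow_le_pow_left₀ hr.le h1 3)
  · have := pow_le_pow_left₀ hp.le h2 3
    rw [mul_one_div, div_le_div_iff₀ (by positivity) (by positivity)]
    nlinarith

lemma sum_lower (r : ℕ → ℝ) (hr : ∀ n, 0 < r n) (h : ∀ n, r n ^ 8 = (n : ℝ) ^ 2 + 1) (M : ℕ) :
    4 * (fr (M + 1) - 1) ≤ ∑ n ∈ Finset.range M, 1 / r n ^ 3 := by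
  induction M with
  | zero => simp [fr]
  | succ M ih =>
    rw [Finset.sum_range_succ]
    have h1 := (r_bounds (r M) M (hr M) (h M)).1
    have h2 := (tele_quarter (fr (M + 1)) (fr (M + 1 + 1)) (fr_nonneg _)
      (by rw [fr_pow, fr_pow]; push_cast; ring) (fr_pos _)).2
    have h3 := fr_pos M
    have h4 : 4 * (fr (M + 1 + 1) - fr (M + 1)) ≤ 1 / fr (M + 1) ^ 3 := by
      rw [le_div_iff₀ (by positivity)]; exact h2
    linarith

lemma sum_upper (r : ℕ → ℝ) (hr : ∀ n, 0 < r n) (h : ∀ n, r n ^ 8 = (n : ℝ) ^ 2 + 1) (M : ℕ) :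
    ∑ n ∈ Finset.range M, 1 / r n ^ 3 ≤ 32 * fr M := by
  induction M with
  | zero => simp [fr]
  | succ M ih =>
    rw [Finset.sum_range_succ]
    have h1 := (r_bounds (r M) M (hr M) (h M)).2.1
    have h2 := (tele_quarter (fr M) (fr (M + 1)) (fr_nonneg _)
      (by rw [fr_pow, fr_pow]; push_cast; ring) (fr_pos _)).1
    linarith

lemma tail_partial (r : ℕ → ℝ) (hr : ∀ n, 0 < r n) (h : ∀ n, r n ^ 8 = (n : ℝ) ^ 2 + 1)
    (L m : ℕ) :
    ∑ i ∈ Finset.range m, 1 / r (i + (L + 2)) ^ 6 ≤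
      2 / √((L + 1 : ℕ) : ℝ) - 2 / √((L + 1 + m : ℕ) : ℝ) := by
  induction m with
  | zero => simp
  | succ m ih =>
    rw [Finset.sum_range_succ]
    have hp : 0 < √((L + 1 + m : ℕ) : ℝ) := by positivity
    have hq : 0 < √((L + 1 + (m + 1) : ℕ) : ℝ) := by positivity
    have h1 := tele_half _ _ hp hq (by
      rw [Real.sq_sqrt (Nat.cast_nonneg _), Real.sq_sqrt (Nat.cast_nonneg _)]; push_cast; ring)
    set q := √((L + 1 + (m + 1) : ℕ) : ℝ) with hqd
    have hq2 : q ^ 2 = ((m + (L + 2) : ℕ) : ℝ) := by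
      rw [hqd, Real.sq_sqrt (Nat.cast_nonneg _)]; push_cast; ring
    have h8 := h (m + (L + 2))
    have hr' := hr (m + (L + 2))
    have h2 : q ≤ r (m + (L + 2)) ^ 2 := by
      apply le_of_pow_le_pow_left₀ (n := 4) (by norm_num) (by positivity)
      calc q ^ 4 = (q ^ 2) ^ 2 := by ring
        _ ≤ r (m + (L + 2)) ^ 8 := by rw [hq2, h8]; linarith
        _ = _ := by ring
    have h3 : 1 / r (m + (L + 2)) ^ 6 ≤ 1 / q ^ 3 := by
      apply one_div_le_one_div_of_le (by positivity)
      calc q ^ 3 ≤ (r (m + (L + 2)) ^ 2) ^ 3 := pow_le_pow_left₀ hq.le h2 3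
        _ = _ := by ring
    linarith

lemma core (r : ℕ → ℝ) (hr : ∀ n, 0 < r n) (h : ∀ n, r n ^ 8 = (n : ℝ) ^ 2 + 1)
    (w : ℝ) (hw : 100 ≤ w) (C : ℕ → ℕ) (M : ℕ) (hM1 : w ^ 4 ≤ M + 1) (hM2 : (M : ℝ) ≤ w ^ 4 + 1)
    (hC : ∀ n < M, w ^ 6 / r n ^ 6 + w ^ 3 / r n ^ 3 - 3 / 4 ≤ (C n : ℝ) ^ 2 ∧
      (C n : ℝ) ^ 2 ≤ w ^ 6 / r n ^ 6 + 6 * (w ^ 3 / r n ^ 3)) :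
    w ^ 4 ≤ ∑ n ∈ Finset.range M, (C n : ℝ) ^ 2 - (∑' n, 1 / r n ^ 6) * w ^ 6 ∧
    ∑ n ∈ Finset.range M, (C n : ℝ) ^ 2 - (∑' n, 1 / r n ^ 6) * w ^ 6 ≤ 1000 * w ^ 4 := by
  have hw4 : (100 : ℝ) ^ 4 ≤ w ^ 4 := pow_le_pow_left₀ (by norm_num) hw 4
  obtain ⟨L, rfl⟩ : ∃ L, M = L + 2 := by
    refine ⟨M - 2, ?_⟩
    have : (2 : ℝ) ≤ M := by linarith
    have : 2 ≤ M := by exact_mod_cast this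
    omega
  have hnn : ∀ n, 0 ≤ 1 / r n ^ 6 := fun n => by have := hr n; positivity
  have htail : ∀ m, ∑ i ∈ Finset.range m, 1 / r (i + (L + 2)) ^ 6 ≤ 2 / √((L + 1 : ℕ) : ℝ) := by
    intro m
    have := tail_partial r hr h L m
    have h2 : 0 ≤ 2 / √((L + 1 + m : ℕ) : ℝ) := by positivity
    linarith
  have hs1 : Summable (fun i => 1 / r (i + (L + 2)) ^ 6) :=
    summable_of_sum_range_le (fun i => hnn _) htail
  have hs : Summable (fun i => 1 / r i ^ 6) := (summable_nat_add_iff (L + 2)).1 hs1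
  have hT := Real.tsum_le_of_sum_range_le (fun i => hnn (i + (L + 2))) htail
  have hT0 : 0 ≤ ∑' i, 1 / r (i + (L + 2)) ^ 6 := tsum_nonneg (fun i => hnn _)
  rw [← hs.sum_add_tsum_nat_add (L + 2)]
  set T := ∑' i, 1 / r (i + (L + 2)) ^ 6
  set S6 := ∑ i ∈ Finset.range (L + 2), 1 / r i ^ 6 with hS6
  set S3 := ∑ i ∈ Finset.range (L + 2), 1 / r i ^ 3 with hS3
  have hl := sum_lower r hr h (L + 2)
  have hu := sum_upper r hr h (L + 2)
  rw [← hS3] at hl hu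
  have hlow : S6 * w ^ 6 + S3 * w ^ 3 - 3 / 4 * ((L + 2 : ℕ) : ℝ) ≤
      ∑ n ∈ Finset.range (L + 2), (C n : ℝ) ^ 2 := by
    have := Finset.sum_le_sum (fun n hn => (hC n (Finset.mem_range.1 hn)).1)
    refine le_trans (le_of_eq ?_) this
    rw [Finset.sum_sub_distrib, Finset.sum_add_distrib, hS6, hS3, Finset.sum_mul, Finset.sum_mul]
    simp only [Finset.sum_const, Finset.card_range, nsmul_eq_mul, one_div, div_eq_mul_inv]
    simp only [mul_comm]
    ring_nf
  have hupp : ∑ n ∈ Finset.range (L + 2), (C n : ℝ) ^ 2 ≤ S6 * w ^ 6 + 6 * (S3 * w ^ 3) := by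
    have := Finset.sum_le_sum (fun n hn => (hC n (Finset.mem_range.1 hn)).2)
    refine le_trans this (le_of_eq ?_)
    rw [Finset.sum_add_distrib, ← Finset.mul_sum, hS6, hS3, Finset.sum_mul, Finset.sum_mul]
    simp only [one_div, div_eq_mul_inv]
    simp only [mul_comm]
    ring_nf
  have hw0 : 0 < w := by linarith
  have hw2 : (100 : ℝ) ^ 2 ≤ w ^ 2 := pow_le_pow_left₀ (by norm_num) hw 2
  have hw3 : 0 < w ^ 3 := by positivity
  have hfl : w ≤ fr (L + 2 + 1) := by
    apply le_of_pow_le_pow_left₀ (n := 4) (by norm_num) (fr_nonneg _)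
    rw [fr_pow]; push_cast at hM1 ⊢; linarith
  have hfu : fr (L + 2) ≤ 2 * w := by
    apply le_of_pow_le_pow_left₀ (n := 4) (by norm_num) (by positivity)
    rw [fr_pow, mul_pow]; linarith
  have hsq : 0.97 * w ^ 2 ≤ √((L + 1 : ℕ) : ℝ) := by
    apply Real.le_sqrt_of_sq_le
    push_cast at hM1 ⊢
    nlinarith
  have hTw : T * w ^ 6 ≤ 2.1 * w ^ 4 := by
    have h1 : T ≤ 2 / (0.97 * w ^ 2) :=
      hT.trans (div_le_div_of_nonneg_left (by norm_num) (by positivity) hsq)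
    calc T * w ^ 6 ≤ 2 / (0.97 * w ^ 2) * w ^ 6 := by gcongr
      _ = 2 / 0.97 * w ^ 4 := by field_simp
      _ ≤ _ := by nlinarith
  have hTw0 : 0 ≤ T * w ^ 6 := by positivity
  have e4 : w ^ 4 = w * w ^ 3 := by ring
  constructor
  · have h1 : 4 * (w - 1) * w ^ 3 ≤ S3 * w ^ 3 := by
      apply mul_le_mul_of_nonneg_right _ hw3.le; linarith
    have h2 : 100 * w ^ 3 ≤ w ^ 4 := by rw [e4]; gcongr
    have h3 : 4 * (w - 1) * w ^ 3 = 4 * w ^ 4 - 4 * w ^ 3 := by ring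
    rw [add_mul]
    linarith
  · have h1 : S3 * w ^ 3 ≤ 64 * w * w ^ 3 := by
      apply mul_le_mul_of_nonneg_right _ hw3.le; linarith
    rw [add_mul]
    nlinarith

lemma sum_odd (C : ℕ) : ∑ k ∈ Finset.range C, 2 * (2 * (k : ℝ) + 1) = 2 * (C : ℝ) ^ 2 := by
  induction C with
  | zero => simp
  | succ C ih => rw [Finset.sum_range_succ, ih]; push_cast; ring

lemma main_bound (τ : ℝ) (hτ : 100 ^ 6 ≤ τ) :
    2 * τ ^ (2 / 3 : ℝ) ≤ |(∑' q : {q : ℕ × ℕ |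
              ((q.1 : ℝ) ^ 2 - (q.1 : ℝ) + 1) * ((q.2 : ℝ) ^ 2 + 1) ^ (3 / 4 : ℝ) < τ},
            2 * (2 * (q.1.1 : ℝ) + 1)) -
          (∑' n : ℕ, 2 * ((n : ℝ) ^ 2 + 1) ^ (-(3 / 4 : ℝ))) * τ| ∧
    |(∑' q : {q : ℕ × ℕ |
              ((q.1 : ℝ) ^ 2 - (q.1 : ℝ) + 1) * ((q.2 : ℝ) ^ 2 + 1) ^ (3 / 4 : ℝ) < τ},
            2 * (2 * (q.1.1 : ℝ) + 1)) -
          (∑' n : ℕ, 2 * ((n : ℝ) ^ 2 + 1) ^ (-(3 / 4 : ℝ))) * τ| ≤ 2000 * τ ^ (2 / 3 : ℝ) := by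
  have hτ0 : 0 < τ := by linarith
  obtain ⟨w, hw0, hw6, hw4⟩ : ∃ w : ℝ, 0 < w ∧ w ^ 6 = τ ∧ w ^ 4 = τ ^ (2 / 3 : ℝ) := by
    refine ⟨τ ^ (1 / 6 : ℝ), by positivity, ?_, ?_⟩
    · rw [← Real.rpow_natCast, ← Real.rpow_mul hτ0.le]; norm_num
    · rw [← Real.rpow_natCast, ← Real.rpow_mul hτ0.le]; norm_num
  have hw : 100 ≤ w := le_of_pow_le_pow_left₀ (n := 6) (by norm_num) hw0.le (by rw [hw6]; exact hτ)
  rw [← hw4, ← hw6]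
  let r : ℕ → ℝ := fun n => ((n : ℝ) ^ 2 + 1) ^ (1 / 8 : ℝ)
  have hr : ∀ n, 0 < r n := fun n => by positivity
  have h8 : ∀ n, r n ^ 8 = (n : ℝ) ^ 2 + 1 := fun n => by
    simp only [r]
    rw [← Real.rpow_natCast, ← Real.rpow_mul (by positivity)]; norm_num
  have h6 : ∀ n : ℕ, ((n : ℝ) ^ 2 + 1) ^ (3 / 4 : ℝ) = r n ^ 6 := fun n => by
    simp only [r]
    rw [← Real.rpow_natCast (((n : ℝ) ^ 2 + 1) ^ (1 / 8 : ℝ)), ← Real.rpow_mul (by positivity)]; norm_num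
  have h6' : ∀ n : ℕ, ((n : ℝ) ^ 2 + 1) ^ (-(3 / 4 : ℝ)) = 1 / r n ^ 6 := fun n => by
    rw [Real.rpow_neg (by positivity), h6, one_div]
  simp only [h6', tsum_mul_left]
  clear_value r
  choose C hC1 hC2 using fun n : ℕ => exists_count (w ^ 6 / r n ^ 6)
  have hw4' : (100 : ℝ) ^ 4 ≤ w ^ 4 := pow_le_pow_left₀ (by norm_num) hw 4
  obtain ⟨M, hM⟩ : ∃ M : ℕ, M = ⌈√((w ^ 4) ^ 2 - 1)⌉₊ := ⟨_, rfl⟩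
  have hMlt : ∀ n : ℕ, n < M ↔ 1 < w ^ 6 / r n ^ 6 := by
    intro n
    have hrn := hr n
    rw [hM, Nat.lt_ceil, Real.lt_sqrt (Nat.cast_nonneg _), one_lt_div (by positivity),
      lt_sub_iff_add_lt, ← h8, pow_lt_pow_iff_left₀ hrn.le hw0.le (by norm_num), ← pow_mul,
      pow_lt_pow_iff_left₀ hrn.le hw0.le (by norm_num)]
  have hM1 : w ^ 4 ≤ M + 1 := by
    have h1 := Nat.le_ceil (√((w ^ 4) ^ 2 - 1))
    rw [← hM] at h1
    have : w ^ 4 - 1 ≤ √((w ^ 4) ^ 2 - 1) := by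
      apply Real.le_sqrt_of_sq_le; nlinarith
    linarith
  have hM2 : (M : ℝ) ≤ w ^ 4 + 1 := by
    have h1 := Nat.ceil_lt_add_one (Real.sqrt_nonneg ((w ^ 4) ^ 2 - 1))
    rw [← hM] at h1
    have : √((w ^ 4) ^ 2 - 1) ≤ w ^ 4 := by
      rw [Real.sqrt_le_left (by positivity)]; linarith
    linarith
  have hcore := core r hr h8 w hw C M hM1 hM2 (fun n hn => by
    have hrn := hr n
    exact hC2 n (w ^ 3 / r n ^ 3) (by positivity) (by field_simp) ((hMlt n).1 hn))
  have hmem : ∀ q : ℕ × ℕ, ((q.1 : ℝ) ^ 2 - (q.1 : ℝ) + 1) * r q.2 ^ 6 < w ^ 6 ↔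
      q.2 ∈ Finset.range M ∧ q.1 ∈ Finset.range (C q.2) := by
    intro q
    have hrn := hr q.2
    rw [Finset.mem_range, Finset.mem_range, hC1, hMlt, ← lt_div_iff₀ (by positivity)]
    refine ⟨fun h => ⟨lt_of_le_of_lt ?_ h, h⟩, fun h => h.2⟩
    have : (q.1 : ℝ) ≤ (q.1 : ℝ) ^ 2 := by exact_mod_cast Nat.le_self_pow (by norm_num) q.1
    linarith
  classical
  let F : Finset (ℕ × ℕ) :=
    ((Finset.range M).sigma (fun n => Finset.range (C n))).image (fun p => (p.2, p.1))
  have hF : ∀ q : ℕ × ℕ, q ∈ F ↔ q.2 ∈ Finset.range M ∧ q.1 ∈ Finset.range (C q.2) := by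
    rintro ⟨k, n⟩
    simp only [F, Finset.mem_image, Finset.mem_sigma, Prod.mk.injEq]
    constructor
    · rintro ⟨⟨a, b⟩, h, rfl, rfl⟩; exact h
    · intro h; exact ⟨⟨n, k⟩, h, rfl, rfl⟩
  have hset : {q : ℕ × ℕ | ((q.1 : ℝ) ^ 2 - (q.1 : ℝ) + 1) * ((q.2 : ℝ) ^ 2 + 1) ^ (3 / 4 : ℝ) < w ^ 6} =
      (F : Set (ℕ × ℕ)) := by
    ext q
    rw [Set.mem_ofPred_eq, h6, hmem, Finset.mem_coe, hF]
  have hsum : (∑' q : {q : ℕ × ℕ | ((q.1 : ℝ) ^ 2 - (q.1 : ℝ) + 1) * ((q.2 : ℝ) ^ 2 + 1) ^ (3 / 4 : ℝ) < w ^ 6},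
      2 * (2 * (q.1.1 : ℝ) + 1)) = 2 * ∑ n ∈ Finset.range M, (C n : ℝ) ^ 2 := by
    rw [hset]
    have := Finset.tsum_subtype' F (fun q : ℕ × ℕ => 2 * (2 * (q.1 : ℝ) + 1))
    refine this.trans ?_
    rw [Finset.sum_finset_product_right F (Finset.range M) (fun n => Finset.range (C n)) hF,
      Finset.mul_sum]
    exact Finset.sum_congr rfl (fun n _ => sum_odd (C n))
  simp only [tsum_mul_left] at hsum
  rw [hsum]
  obtain ⟨ha, hb⟩ := hcore
  have hp : 0 < w ^ 4 := by positivity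
  rw [abs_of_nonneg (by linarith)]
  constructor <;> linarith

theorem sharpness_case_three :
    2 ≤ Filter.limsup (fun τ : ℝ =>
        |(∑' q : {q : ℕ × ℕ |
              ((q.1 : ℝ) ^ 2 - (q.1 : ℝ) + 1) * ((q.2 : ℝ) ^ 2 + 1) ^ (3 / 4 : ℝ) < τ},
            2 * (2 * (q.1.1 : ℝ) + 1)) -
          (∑' n : ℕ, 2 * ((n : ℝ) ^ 2 + 1) ^ (-(3 / 4 : ℝ))) * τ| /
        τ ^ (2 / 3 : ℝ)) Filter.atTop := by
  apply Filter.le_limsup_of_frequently_le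
  · apply Filter.Eventually.frequently
    filter_upwards [Filter.eventually_ge_atTop (100 ^ 6 : ℝ)] with τ hτ
    have hτ0 : 0 < τ := by linarith
    rw [le_div_iff₀ (by positivity)]
    exact (main_bound τ hτ).1
  · refine ⟨2000, ?_⟩
    rw [Filter.eventually_map]
    filter_upwards [Filter.eventually_ge_atTop (100 ^ 6 : ℝ)] with τ hτ
    have hτ0 : 0 < τ := by linarith
    rw [div_le_iff₀ (by positivity)]
    exact (main_bound τ hτ).2
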